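/- arXiv:2305.17596 — 5 statements merged into one kernel-verified Lean document; each statement's English description precedes it below -/
import Mathlib

section
/- Let n : ℕ, B : Matrix (Fin n) (Fin n) ℝ, and q, b : Fin n → ℝ. If (B, q) is a refining pair, i.e., B is invertible and every entry of (Bᵀ)⁻¹.mulVec q is nonnegative, then q ⬝ᵥ (B⁻¹.mulVec b) is the greatest element of the set {v : ℝ | ∃ y : Fin n → ℝ, B.mulVec y ≤ b ∧ v = q ⬝ᵥ y}; that is, the linear program maximizing qᵀy subject to By ≤ b attains the optimal value qᵀB⁻¹b. (Lemma on symbolic linear programs, refining-pair part.) -/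
open Matrix

/-- Lemma on symbolic linear programs, refining-pair part: if (B, q) is a refining pair,
the LP maximizing qᵀy subject to By ≤ b attains the optimal value qᵀB⁻¹b. -/
theorem refining_pair_lp_max {n : ℕ} (B : Matrix (Fin n) (Fin n) ℝ) (q b : Fin n → ℝ)
    (hB : IsUnit B) (hq : ∀ i, 0 ≤ (Bᵀ)⁻¹.mulVec q i) :
    IsGreatest {v : ℝ | ∃ y : Fin n → ℝ, B.mulVec y ≤ b ∧ v = q ⬝ᵥ y}
      (q ⬝ᵥ B⁻¹.mulVec b) := by
  have hdet := (isUnit_iff_isUnit_det B).mp hB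
  refine ⟨⟨B⁻¹.mulVec b, ?_, rfl⟩, ?_⟩
  · rw [mulVec_mulVec, mul_nonsing_inv B hdet, one_mulVec]
  · rintro _ ⟨y, hy, rfl⟩
    have hy_eq : y = B⁻¹.mulVec (B.mulVec y) := by
      rw [mulVec_mulVec, nonsing_inv_mul B hdet, one_mulVec]
    have hq' : 0 ≤ q ᵥ* B⁻¹ := by
      rw [← mulVec_transpose, transpose_nonsing_inv]
      exact hq
    calc q ⬝ᵥ y = (q ᵥ* B⁻¹) ⬝ᵥ B.mulVec y := by
          rw [← dotProduct_mulVec, ← hy_eq]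
      _ ≤ (q ᵥ* B⁻¹) ⬝ᵥ b := dotProduct_le_dotProduct_of_nonneg_left hy hq'
      _ = q ⬝ᵥ B⁻¹.mulVec b := (dotProduct_mulVec q B⁻¹ b).symm
end

section
/- Let n : ℕ, B : Matrix (Fin n) (Fin n) ℝ, and q, b : Fin n → ℝ. If (B, q) is a relaxing pair, i.e., B is invertible and every entry of -((Bᵀ)⁻¹.mulVec q) is nonnegative, then q ⬝ᵥ (B⁻¹.mulVec b) is the least element of the set {v : ℝ | ∃ y : Fin n → ℝ, B.mulVec y ≤ b ∧ v = q ⬝ᵥ y}; that is, the linear program minimizing qᵀy subject to By ≤ b attains the optimal value qᵀB⁻¹b. (Lemma on symbolic linear programs, relaxing-pair part.) -/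
open Matrix

/-- Lemma on symbolic linear programs, relaxing-pair part: if (B, q) is a relaxing pair,
the LP minimizing qᵀy subject to By ≤ b attains the optimal value qᵀB⁻¹b. -/
theorem relaxing_pair_lp_min {n : ℕ} (B : Matrix (Fin n) (Fin n) ℝ) (q b : Fin n → ℝ)
    (hB : IsUnit B) (hq : ∀ i, 0 ≤ -((Bᵀ)⁻¹.mulVec q) i) :
    IsLeast {v : ℝ | ∃ y : Fin n → ℝ, B.mulVec y ≤ b ∧ v = q ⬝ᵥ y}
      (q ⬝ᵥ B⁻¹.mulVec b) := by
  have hdet : IsUnit B.det := (Matrix.isUnit_iff_isUnit_det B).mp hB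
  have hdual : ∀ z : Fin n → ℝ, q ⬝ᵥ B⁻¹.mulVec z = (Bᵀ)⁻¹.mulVec q ⬝ᵥ z := by
    intro z
    rw [Matrix.dotProduct_mulVec, ← Matrix.transpose_nonsing_inv, Matrix.mulVec_transpose]
  refine ⟨⟨B⁻¹.mulVec b, ?_, rfl⟩, ?_⟩
  · rw [Matrix.mulVec_mulVec, Matrix.mul_nonsing_inv B hdet, Matrix.one_mulVec]
  · rintro v ⟨y, hy, rfl⟩
    have hy' : q ⬝ᵥ y = (Bᵀ)⁻¹.mulVec q ⬝ᵥ B.mulVec y := by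
      rw [← hdual, Matrix.mulVec_mulVec, Matrix.nonsing_inv_mul B hdet, Matrix.one_mulVec]
    rw [hy', hdual]
    exact Finset.sum_le_sum fun i _ =>
      mul_le_mul_of_nonpos_left (hy i) (neg_nonneg.mp (hq i))
end

section
/- Let N, n, m : ℕ, B : Matrix (Fin N) (Fin n) ℝ, b : Fin N → ℝ, p : Fin m → ℝ, q : Fin n → ℝ, r : ℝ, and let J : Fin n → Fin N be injective. Set B_J := B.submatrix J id and b_J := b ∘ J. If (B_J, q) is a refining pair, i.e., B_J is invertible and every entry of (B_Jᵀ)⁻¹.mulVec q is nonnegative, then for all x : Fin m → ℝ and y : Fin n → ℝ: if B.mulVec y ≤ b (entrywise) and p ⬝ᵥ x + q ⬝ᵥ (B_J⁻¹.mulVec b_J) ≤ r, then p ⬝ᵥ x + q ⬝ᵥ y ≤ r. That is, pᵀx + qᵀB_J⁻¹b_J ≤ r is a Y-antecedent of pᵀx + qᵀy ≤ r in the context By ≤ b. (Corollary: explicit antecedent formula from a refining pair selected from the context.) -/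
open Matrix

/-- If every entry of `(Aᵀ)⁻¹ q` is nonnegative, then `y ↦ q ⬝ᵥ y` is bounded above on
`{y | A y ≤ c}` by its value at the vertex `A⁻¹ c`. -/
theorem dotProduct_le_dotProduct_inv_mulVec {ι : Type*} [Fintype ι] [DecidableEq ι]
    {A : Matrix ι ι ℝ} (hA : IsUnit A) {q : ι → ℝ} (hq : 0 ≤ (Aᵀ)⁻¹.mulVec q)
    {y c : ι → ℝ} (hy : A.mulVec y ≤ c) : q ⬝ᵥ y ≤ q ⬝ᵥ A⁻¹.mulVec c := by
  have key (v : ι → ℝ) : q ⬝ᵥ A⁻¹.mulVec v = (Aᵀ)⁻¹.mulVec q ⬝ᵥ v := by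
    rw [dotProduct_mulVec, ← transpose_nonsing_inv, mulVec_transpose]
  calc
    q ⬝ᵥ y = q ⬝ᵥ A⁻¹.mulVec (A.mulVec y) := by
      rw [mulVec_mulVec, nonsing_inv_mul A ((isUnit_iff_isUnit_det A).mp hA), one_mulVec]
    _ ≤ q ⬝ᵥ A⁻¹.mulVec c := by
      rw [key, key]
      exact dotProduct_le_dotProduct_of_nonneg_left hy hq

/-- Corollary: explicit antecedent formula from a refining pair selected from the context.
If (B_J, q) is a refining pair, then pᵀx + qᵀB_J⁻¹b_J ≤ r is a Y-antecedent of
pᵀx + qᵀy ≤ r in the context By ≤ b. -/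
theorem refining_pair_antecedent {N n m : ℕ}
    (B : Matrix (Fin N) (Fin n) ℝ) (b : Fin N → ℝ)
    (p : Fin m → ℝ) (q : Fin n → ℝ) (r : ℝ)
    (J : Fin n → Fin N) (hJ : Function.Injective J)
    (hBJ : IsUnit (B.submatrix J id))
    (hq : ∀ i, 0 ≤ ((B.submatrix J id)ᵀ)⁻¹.mulVec q i) :
    ∀ (x : Fin m → ℝ) (y : Fin n → ℝ),
      B.mulVec y ≤ b →
      p ⬝ᵥ x + q ⬝ᵥ ((B.submatrix J id)⁻¹.mulVec (b ∘ J)) ≤ r →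
      p ⬝ᵥ x + q ⬝ᵥ y ≤ r := by
  intro x y hy hr
  have hyJ : (B.submatrix J id).mulVec y ≤ b ∘ J := fun i => hy (J i)
  exact (add_le_add_right (dotProduct_le_dotProduct_inv_mulVec hBJ hq hyJ) _).trans hr
end

section
/- Let n : ℕ, B : Matrix (Fin n) (Fin n) ℝ, and q : Fin n → ℝ. Let Q : Matrix (Fin n) (Fin n) ℝ be the diagonal matrix whose i-th diagonal entry is Real.sign (q i), and set B̄ := B * Q and q̄ := Q.mulVec q. Suppose (B̄ᵀ, q̄) is a Kaykobad pair, i.e.: every entry of B̄ᵀ is nonnegative, every diagonal entry of B̄ᵀ is positive, every entry of q̄ is positive, and for every i, q̄ i > ∑_{j ≠ i} (B̄ᵀ) i j * (q̄ j / (B̄ᵀ) j j). Then B is invertible and every entry of (Bᵀ)⁻¹.mulVec q is positive; in particular (B, q) is a refining pair. (Lemma reducing the refining-pair condition to Kaykobad's criterion.) -/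
open Matrix

/-- If `C` is entrywise nonnegative and strictly diagonally dominant by rows, then the solution of
`C y = diag C` is entrywise positive. -/
theorem pos_of_mulVec_eq_diag {ι : Type*} [Fintype ι] [DecidableEq ι]
    {C : Matrix ι ι ℝ} {y : ι → ℝ} (hC : ∀ i j, 0 ≤ C i j)
    (hdom : ∀ i, ∑ j ∈ Finset.univ.erase i, C i j < C i i)
    (hy : ∀ i, C.mulVec y i = C i i) (i : ι) : 0 < y i := by
  have : Nonempty ι := ⟨i⟩
  obtain ⟨k, hk⟩ := Finite.exists_min y
  obtain ⟨p, hp⟩ := Finite.exists_max y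
  have hrow (a : ι) : C a a * y a + ∑ j ∈ Finset.univ.erase a, C a j * y j = C a a := by
    rw [Finset.add_sum_erase Finset.univ (fun j => C a j * y j) (Finset.mem_univ a)]
    exact hy a
  have hsum (a : ι) : 0 ≤ ∑ j ∈ Finset.univ.erase a, C a j :=
    Finset.sum_nonneg fun j _ => hC a j
  have hdiag (a : ι) : 0 < C a a := (hsum a).trans_lt (hdom a)
  have hupper : ∑ j ∈ Finset.univ.erase k, C k j * y j
      ≤ (∑ j ∈ Finset.univ.erase k, C k j) * y p := by
    rw [Finset.sum_mul]
    exact Finset.sum_le_sum fun j _ => mul_le_mul_of_nonneg_left (hp j) (hC k j)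
  have hlower : (∑ j ∈ Finset.univ.erase p, C p j) * y k
      ≤ ∑ j ∈ Finset.univ.erase p, C p j * y j := by
    rw [Finset.sum_mul]
    exact Finset.sum_le_sum fun j _ => mul_le_mul_of_nonneg_left (hk j) (hC p j)
  refine lt_of_lt_of_le ?_ (hk i)
  by_contra! hneg
  have hmax : 0 < y p := by
    by_contra! hmax
    have := mul_nonpos_of_nonneg_of_nonpos (hsum k) hmax
    have := mul_nonpos_of_nonneg_of_nonpos (hdiag k).le hneg
    linarith [hrow k, hdiag k]
  have hgt : 1 < y k + y p := by
    have := mul_lt_mul_of_pos_right (hdom k) hmax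
    refine lt_of_mul_lt_mul_left ?_ (hdiag k).le
    linarith [hrow k]
  have hle : y k + y p ≤ 1 := by
    have := mul_le_mul_of_nonpos_right (hdom p).le hneg
    refine le_of_mul_le_mul_left ?_ (hdiag p)
    linarith [hrow p]
  exact hgt.not_ge hle

/-- **Kaykobad's theorem**. -/
theorem kaykobad {ι : Type*} [Fintype ι] [DecidableEq ι] {M : Matrix ι ι ℝ} {v : ι → ℝ}
    (hM : ∀ i j, 0 ≤ M i j) (hdiag : ∀ i, 0 < M i i) (hv : ∀ i, 0 < v i)
    (hdom : ∀ i, ∑ j ∈ Finset.univ.erase i, M i j * (v j / M j j) < v i) :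
    M.det ≠ 0 ∧ ∀ x, M.mulVec x = v → ∀ i, 0 < x i := by
  set w : ι → ℝ := fun j => v j / M j j
  have hw (j : ι) : 0 < w j := div_pos (hv j) (hdiag j)
  have hC (i j : ι) : (M * diagonal w) i j = M i j * w j := mul_diagonal w M i j
  have hCdiag (i : ι) : (M * diagonal w) i i = v i := by
    rw [hC, mul_div_cancel₀ _ (hdiag i).ne']
  have hCnonneg (i j : ι) : 0 ≤ (M * diagonal w) i j := by
    rw [hC]
    exact mul_nonneg (hM i j) (hw j).le
  have hCdom (i : ι) : ∑ j ∈ Finset.univ.erase i, (M * diagonal w) i j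
      < (M * diagonal w) i i := by
    rw [hCdiag]
    simpa only [hC] using hdom i
  constructor
  · have hdet : (M * diagonal w).det ≠ 0 := det_ne_zero_of_sum_row_lt_diag fun i => by
      simpa only [Real.norm_of_nonneg (hCnonneg _ _)] using hCdom i
    rw [det_mul] at hdet
    exact left_ne_zero_of_mul hdet
  · intro x hx i
    have hcancel : (diagonal w).mulVec (fun j => x j / w j) = x := by
      ext j
      rw [mulVec_diagonal, mul_div_cancel₀ _ (hw j).ne']
    have hpos := pos_of_mulVec_eq_diag hCnonneg hCdom
      (y := fun j => x j / w j) (fun j => by rw [← mulVec_mulVec, hcancel, hx, hCdiag]) i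
    exact (div_pos_iff_of_pos_right (hw i)).1 hpos

/-- Lemma reducing the refining-pair condition to Kaykobad's criterion: if
(B̄ᵀ, q̄) is a Kaykobad pair, with B̄ = BQ and q̄ = Qq for Q = diag(sign(qᵢ)),
then B is invertible and (Bᵀ)⁻¹ q has positive entries. -/
theorem kaykobad_refining_pair {n : ℕ}
    (B : Matrix (Fin n) (Fin n) ℝ) (q : Fin n → ℝ)
    (Q : Matrix (Fin n) (Fin n) ℝ)
    (hQ : Q = Matrix.diagonal (fun i => Real.sign (q i)))
    (Bbar : Matrix (Fin n) (Fin n) ℝ) (hBbar : Bbar = B * Q)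
    (qbar : Fin n → ℝ) (hqbar : qbar = Q.mulVec q)
    (hnonneg : ∀ i j, 0 ≤ Bbarᵀ i j)
    (hdiag : ∀ i, 0 < Bbarᵀ i i)
    (hqpos : ∀ i, 0 < qbar i)
    (hdom : ∀ i, ∑ j ∈ Finset.univ.erase i, Bbarᵀ i j * (qbar j / Bbarᵀ j j) < qbar i) :
    IsUnit B ∧ ∀ i, 0 < (Bᵀ)⁻¹.mulVec q i := by
  subst hQ hBbar hqbar
  obtain ⟨hdet, hpos⟩ := kaykobad hnonneg hdiag hqpos hdom
  have hB : IsUnit B.det := by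
    rw [det_transpose, det_mul] at hdet
    exact (left_ne_zero_of_mul hdet).isUnit
  refine ⟨(isUnit_iff_isUnit_det B).2 hB, hpos _ ?_⟩
  rw [transpose_mul, diagonal_transpose, ← mulVec_mulVec, mulVec_mulVec _ Bᵀ,
    mul_nonsing_inv _ (by rwa [det_transpose]), one_mulVec]
end

section
/- Let N, n : ℕ, B : Matrix (Fin N) (Fin n) ℝ, b : Fin N → ℝ, q : Fin n → ℝ. Suppose y⋆ : Fin n → ℝ is an optimal solution of the linear program maximizing qᵀy subject to By ≤ b, i.e., B.mulVec y⋆ ≤ b (entrywise) and q ⬝ᵥ y ≤ q ⬝ᵥ y⋆ for every y with B.mulVec y ≤ b. Let J : Fin n → Fin N be injective with range exactly the set of active constraints, i.e., {i : Fin N | B.mulVec y⋆ i = b i} = Set.range J, and set B_J := B.submatrix J id. If B_J is invertible, then every entry of (B_Jᵀ)⁻¹.mulVec q is nonnegative; that is, (B_J, q) is a refining pair. (Lemma: computing the index set J via linear programming yields a refining pair.) -/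
open Matrix

open Filter Topology in
/-- At a maximizer of a linear program, the objective does not increase along any direction that
does not increase the active constraints. -/
theorem dotProduct_nonpos_of_active_nonpos {ι κ : Type*} [Finite κ] [Fintype ι]
    {B : Matrix κ ι ℝ} {b : κ → ℝ} {q y d : ι → ℝ}
    (hfeas : B.mulVec y ≤ b)
    (hopt : ∀ z : ι → ℝ, B.mulVec z ≤ b → q ⬝ᵥ z ≤ q ⬝ᵥ y)
    (hd : ∀ k, B.mulVec y k = b k → B.mulVec d k ≤ 0) :
    q ⬝ᵥ d ≤ 0 := by
  have hev : ∀ᶠ t : ℝ in 𝓝[>] 0, ∀ k, B.mulVec y k + t * B.mulVec d k ≤ b k := by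
    refine eventually_all.2 fun k => ?_
    rcases (hfeas k).eq_or_lt with h | h
    · filter_upwards [self_mem_nhdsWithin] with t (ht : 0 < t)
      linarith [mul_nonpos_of_nonneg_of_nonpos ht.le (hd k h)]
    · have hc : Tendsto (fun t : ℝ => B.mulVec y k + t * B.mulVec d k) (𝓝 0)
          (𝓝 (B.mulVec y k + 0 * B.mulVec d k)) :=
        Continuous.tendsto (by fun_prop) 0
      rw [zero_mul, add_zero] at hc
      exact ((hc.eventually_lt_const h).filter_mono nhdsWithin_le_nhds).mono fun _ => le_of_lt
  obtain ⟨t, htB, ht⟩ := (hev.and self_mem_nhdsWithin).exists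
  have ht : 0 < t := ht
  have h := hopt (y + t • d) fun k => by
    simpa [mulVec_add, mulVec_smul] using htB k
  rw [dotProduct_add, dotProduct_smul, smul_eq_mul] at h
  exact nonpos_of_mul_nonpos_right (by linarith) ht

/-- Lemma: computing the index set J via linear programming yields a refining pair.
If y⋆ is optimal for max qᵀy s.t. By ≤ b, J enumerates exactly the active constraints,
and B_J is invertible, then (B_J, q) is a refining pair. -/
theorem lp_active_set_refining_pair {N n : ℕ}
    (B : Matrix (Fin N) (Fin n) ℝ) (b : Fin N → ℝ) (q : Fin n → ℝ)
    (ystar : Fin n → ℝ)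
    (hfeas : B.mulVec ystar ≤ b)
    (hopt : ∀ y : Fin n → ℝ, B.mulVec y ≤ b → q ⬝ᵥ y ≤ q ⬝ᵥ ystar)
    (J : Fin n → Fin N) (hJ : Function.Injective J)
    (hactive : {i : Fin N | B.mulVec ystar i = b i} = Set.range J)
    (hBJ : IsUnit (B.submatrix J id)) :
    ∀ i, 0 ≤ ((B.submatrix J id)ᵀ)⁻¹.mulVec q i := by
  intro i
  set M := B.submatrix J id with hM
  have hdet : IsUnit M.det := (isUnit_iff_isUnit_det M).1 hBJ
  have hMd : M.mulVec (M⁻¹.mulVec (-Pi.single i 1)) = -Pi.single i 1 := by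
    rw [mulVec_mulVec, mul_nonsing_inv M hdet, one_mulVec]
  have hle : q ⬝ᵥ M⁻¹.mulVec (-Pi.single i 1) ≤ 0 := by
    refine dotProduct_nonpos_of_active_nonpos hfeas hopt fun k hk => ?_
    obtain ⟨j, rfl⟩ : k ∈ Set.range J := hactive ▸ hk
    change M.mulVec _ j ≤ 0
    rw [hMd, Pi.neg_apply, neg_nonpos]
    exact (Pi.single_nonneg.2 zero_le_one : (0 : Fin n → ℝ) ≤ Pi.single i 1) j
  rw [mulVec_neg, dotProduct_neg, neg_nonpos, dotProduct_mulVec, dotProduct_single_one] at hle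
  rwa [← transpose_nonsing_inv, mulVec_transpose]
end
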